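/- There exist absolute constants c₁, c₂ > 0 such that for every real P ≥ 3: (i) for every n ∈ ℋ₂, c₁ (log P)^{−1} ≤ 𝔓₂(n,P) ≤ c₂ log P; (ii) for every n ∈ ℋ₃, c₁ (log P)^{−3} ≤ 𝔓₃(n,P) ≤ c₂ (log P)³. -/

import Mathlib

open scoped Classical
open MeasureTheory

noncomputable section

/-- `e x = exp(2 π i x)`. -/
def e (x : ℝ) : ℂ := Complex.exp (2 * Real.pi * Complex.I * x)

/-- `S(q,a) = ∑_{1 ≤ x ≤ q, (x,q)=1} e(a x² / q)`. -/
def Sqa (q : ℕ) (a : ℤ) : ℂ :=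
  ∑ x ∈ (Finset.Icc 1 q).filter (fun x => Nat.gcd x q = 1),
    e ((a : ℝ) * (x : ℝ) ^ 2 / (q : ℝ))

/-- `A₂(n,q) = (μ(q)/φ(q)²) ∑_{1 ≤ a ≤ q, (a,q)=1} S(q,a) e(-a n / q)`. -/
def A2 (n q : ℕ) : ℂ :=
  (((ArithmeticFunction.moebius q : ℤ) : ℝ) / ((Nat.totient q : ℝ)) ^ 2 : ℝ) *
    ∑ a ∈ (Finset.Icc 1 q).filter (fun a => Nat.gcd a q = 1),
      Sqa q a * e (-((a : ℝ) * (n : ℝ) / (q : ℝ)))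

/-- `A₃(n,q) = φ(q)⁻³ ∑_{1 ≤ a ≤ q, (a,q)=1} S(q,a)³ e(-a n / q)`. -/
def A3 (n q : ℕ) : ℂ :=
  ((((Nat.totient q : ℝ)) ^ 3)⁻¹ : ℝ) *
    ∑ a ∈ (Finset.Icc 1 q).filter (fun a => Nat.gcd a q = 1),
      (Sqa q a) ^ 3 * e (-((a : ℝ) * (n : ℝ) / (q : ℝ)))

/-- `𝔖₂(n,P) = ∑_{1 ≤ q ≤ P} A₂(n,q)`. -/
def SS2 (n : ℕ) (P : ℝ) : ℂ := ∑ q ∈ Finset.Icc 1 ⌊P⌋₊, A2 n q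

/-- `𝔖₃(n,P) = ∑_{1 ≤ q ≤ P} A₃(n,q)`. -/
def SS3 (n : ℕ) (P : ℝ) : ℂ := ∑ q ∈ Finset.Icc 1 ⌊P⌋₊, A3 n q

/-- `𝔓₂(n,Q) = ∏_{p ≤ Q} (1 + A₂(n,p) + A₂(n,p²) + ⋯)`. -/
def PP2 (n : ℕ) (Q : ℝ) : ℂ :=
  ∏ p ∈ (Finset.Icc 1 ⌊Q⌋₊).filter Nat.Prime, (1 + ∑' k : ℕ, A2 n (p ^ (k + 1)))

/-- `𝔓₃(n,Q) = ∏_{p ≤ Q} (1 + A₃(n,p) + A₃(n,p²) + ⋯)`. -/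
def PP3 (n : ℕ) (Q : ℝ) : ℂ :=
  ∏ p ∈ (Finset.Icc 1 ⌊Q⌋₊).filter Nat.Prime, (1 + ∑' k : ℕ, A3 n (p ^ (k + 1)))

/-- `n ∈ ℋ₂`: `n` is a positive even integer with `n ≢ 1 (mod 3)`. -/
def H2mem (n : ℕ) : Prop := 0 < n ∧ 2 ∣ n ∧ n % 3 ≠ 1

/-- `n ∈ ℋ₃`: `n ≡ 3 (mod 24)` and `5 ∤ n`. -/
def H3mem (n : ℕ) : Prop := n % 24 = 3 ∧ ¬ (5 ∣ n)

/-- `m ∈ I₁ = [X - Y, X)`. -/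
def inI1 (X Y : ℝ) (m : ℕ) : Prop := X - Y ≤ (m : ℝ) ∧ (m : ℝ) < X

/-- `m ∈ I₂ = [Y^{1/2}/2, Y^{1/2})`. -/
def inI2 (Y : ℝ) (m : ℕ) : Prop := Real.sqrt Y / 2 ≤ (m : ℝ) ∧ (m : ℝ) < Real.sqrt Y

/-- `R₂(n)`: the number of pairs of primes `(p₁, p₂)` with `p₁ + p₂² = n`,
`p₁ ∈ I₁`, `p₂ ∈ I₂`. -/
def R2cnt (X Y : ℝ) (n : ℕ) : ℕ :=
  Nat.card {p : ℕ × ℕ // p.1.Prime ∧ p.2.Prime ∧ p.1 + p.2 ^ 2 = n ∧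
    inI1 X Y p.1 ∧ inI2 Y p.2}

/-- `r₂(n) = ∑_{m₁ + m₂² = n, m₁ ∈ I₁, m₂ ∈ I₂} 1 / (log m₁ · log m₂)`,
summed over pairs of positive integers. -/
def r2 (X Y : ℝ) (n : ℕ) : ℝ :=
  ∑ m ∈ Finset.Ioc 0 n ×ˢ Finset.Ioc 0 n,
    if m.1 + m.2 ^ 2 = n ∧ inI1 X Y m.1 ∧ inI2 Y m.2
    then 1 / (Real.log m.1 * Real.log m.2) else 0

/-- The major arcs `𝔐 = ⋃_{q ≤ P} ⋃_{1 ≤ a ≤ q, (a,q)=1} [a/q - 1/(qQ), a/q + 1/(qQ)]`. -/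
def majorArcs (P Q : ℝ) : Set ℝ :=
  ⋃ q ∈ Finset.Icc 1 ⌊P⌋₊, ⋃ a ∈ (Finset.Icc 1 q).filter (fun a => Nat.gcd a q = 1),
    Set.Icc ((a : ℝ) / q - 1 / (q * Q)) ((a : ℝ) / q + 1 / (q * Q))

/-- The minor arcs `𝔪 = [1/Q, 1 + 1/Q] ∖ 𝔐`. -/
def minorArcs (P Q : ℝ) : Set ℝ := Set.Icc (1 / Q) (1 + 1 / Q) \ majorArcs P Q

/-- `D(χ) = 1` if `χ` is principal, `0` otherwise. -/
def Dind {q : ℕ} (χ : DirichletCharacter ℂ q) : ℂ := if χ = 1 then 1 else 0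

open ZMod in
lemma e_eq (q : ℕ) [NeZero q] (k : ℤ) : e ((k : ℝ) / q) = stdAddChar (k : ZMod q) := by
  rw [stdAddChar_coe, e]
  congr 1
  push_cast
  ring

lemma sum_cop (q : ℕ) [NeZero q] (f : ZMod q → ℂ) :
    ∑ x ∈ (Finset.Icc 1 q).filter (fun x => Nat.gcd x q = 1), f (x : ZMod q)
      = ∑ u : (ZMod q)ˣ, f u := by
  have hq : 0 < q := Nat.pos_of_ne_zero (NeZero.ne q)
  refine Finset.sum_bij (fun x hx => ZMod.unitOfCoprime x (Finset.mem_filter.1 hx).2) ?_ ?_ ?_ ?_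
  · intros; simp
  · intro a ha b hb h
    have h1 : (a : ZMod q) = b := by
      have := congrArg Units.val h
      simpa using this
    rw [ZMod.natCast_eq_natCast_iff] at h1
    simp only [Finset.mem_filter, Finset.mem_Icc] at ha hb
    obtain ⟨⟨ha1, ha2⟩, -⟩ := ha
    obtain ⟨⟨hb1, hb2⟩, -⟩ := hb
    zify at ha1 ha2 hb1 hb2 hq
    by_contra hne
    have h2 := (Nat.modEq_iff_dvd.1 h1)
    obtain ⟨c, hc⟩ := h2
    have : c = 0 := by
      rcases lt_trichotomy c 0 with h | h | h
      · nlinarith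
      · exact h
      · nlinarith
    subst this
    omega
  · intro u _
    by_cases h1 : q = 1
    · subst h1
      exact ⟨1, by simp, Subsingleton.elim _ _⟩
    · have hv := ZMod.val_coe_unit_coprime u
      have hlt := ZMod.val_lt (u : ZMod q)
      refine ⟨(u : ZMod q).val, ?_, ?_⟩
      · simp only [Finset.mem_filter, Finset.mem_Icc]
        refine ⟨⟨?_, hlt.le⟩, hv⟩
        rcases Nat.eq_zero_or_pos (u : ZMod q).val with h | h
        · rw [h] at hv; simp at hv; omega
        · exact h
      · ext; simp
  · intro a ha
    simp

/-- unit square sum -/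
def GG (q : ℕ) [NeZero q] (a : ZMod q) : ℂ :=
  ∑ u : (ZMod q)ˣ, ZMod.stdAddChar (a * (u : ZMod q) ^ 2)

lemma Sqa_eq (q : ℕ) [NeZero q] (a : ℤ) : Sqa q a = GG q (a : ZMod q) := by
  rw [Sqa, GG, ← sum_cop q (fun u => ZMod.stdAddChar ((a : ZMod q) * u ^ 2))]
  refine Finset.sum_congr rfl fun x _ => ?_
  have := e_eq q (a * x ^ 2)
  push_cast at this
  exact this

lemma e_neg (q : ℕ) [NeZero q] (a n : ℕ) :
    e (-((a : ℝ) * (n : ℝ) / (q : ℝ))) = ZMod.stdAddChar (-((a : ZMod q) * (n : ZMod q))) := by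
  have := e_eq q (-(a * n))
  push_cast at this
  rw [← this]
  congr 1
  ring

lemma A2_eq (n q : ℕ) [NeZero q] : A2 n q =
    (((ArithmeticFunction.moebius q : ℤ) : ℝ) / ((Nat.totient q : ℝ)) ^ 2 : ℝ) *
      ∑ v : (ZMod q)ˣ, GG q v * ZMod.stdAddChar (-((v : ZMod q) * (n : ZMod q))) := by
  rw [A2, ← sum_cop q (fun v => GG q v * ZMod.stdAddChar (-(v * (n : ZMod q))))]
  congr 1
  refine Finset.sum_congr rfl fun x _ => ?_
  rw [Sqa_eq, e_neg]
  simp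

lemma A3_eq (n q : ℕ) [NeZero q] : A3 n q =
    ((((Nat.totient q : ℝ)) ^ 3)⁻¹ : ℝ) *
      ∑ v : (ZMod q)ˣ, (GG q v) ^ 3 * ZMod.stdAddChar (-((v : ZMod q) * (n : ZMod q))) := by
  rw [A3, ← sum_cop q (fun v => (GG q v) ^ 3 * ZMod.stdAddChar (-(v * (n : ZMod q))))]
  congr 1
  refine Finset.sum_congr rfl fun x _ => ?_
  rw [Sqa_eq, e_neg]
  simp

lemma GG_zero (q : ℕ) [NeZero q] (h : ZMod q) (h2 : h ^ 2 = 0) (h3 : 2 * h ≠ 0) (a : (ZMod q)ˣ) :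
    GG q a = 0 := by
  have key : ∀ t : ℕ, GG q a = ∑ u : (ZMod q)ˣ, ZMod.stdAddChar ((a : ZMod q) * (u : ZMod q) ^ 2) *
      (ZMod.stdAddChar ((a : ZMod q) * (u : ZMod q) ^ 2 * (2 * h))) ^ t := by
    intro t
    let w : (ZMod q)ˣ := ⟨1 + t * h, 1 - t * h, by linear_combination (-(t:ZMod q)^2) * h2,
      by linear_combination (-(t:ZMod q)^2) * h2⟩
    rw [GG, ← Equiv.sum_comp (Equiv.mulRight w)]
    refine Finset.sum_congr rfl fun u _ => ?_
    rw [← AddChar.map_nsmul_eq_pow, ← AddChar.map_add_eq_mul]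
    congr 1
    simp only [Equiv.coe_mulRight, Units.val_mul, w, nsmul_eq_mul]
    linear_combination ((a : ZMod q) * (u : ZMod q) ^ 2 * t ^ 2) * h2
  have hs : ∑ t ∈ Finset.range q, GG q a = 0 := by
    rw [Finset.sum_congr rfl (fun t _ => key t), Finset.sum_comm]
    refine Finset.sum_eq_zero fun u _ => ?_
    rw [← Finset.mul_sum]
    set z := (ZMod.stdAddChar ((a : ZMod q) * (u : ZMod q) ^ 2 * (2 * h))) with hz
    have hz1 : z ≠ 1 := by
      intro hh
      rw [hz, ← (ZMod.stdAddChar (N := q)).map_zero_eq_one, ZMod.injective_stdAddChar.eq_iff] at hh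
      apply h3
      have := (a * u ^ 2).isUnit
      rw [← Units.val_pow_eq_pow_val, ← Units.val_mul] at hh
      exact (this.mul_right_eq_zero).1 hh
    have hzq : z ^ q = 1 := by
      rw [hz, ← AddChar.map_nsmul_eq_pow]
      simp
    have := geom_sum_eq hz1 q
    rw [this, hzq]
    simp
  simp at hs
  rcases hs with h | h
  · exact absurd h (NeZero.ne q)
  · exact h

lemma A3_zero_of (n q : ℕ) [NeZero q] (h : ZMod q) (h2 : h ^ 2 = 0) (h3 : 2 * h ≠ 0) :
    A3 n q = 0 := by
  rw [A3_eq]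
  simp [GG_zero q h h2 h3]

lemma A3_odd_zero (n p k : ℕ) (hp : p.Prime) (h2 : p ≠ 2) (hk : 1 ≤ k) : A3 n (p ^ (k + 1)) = 0 := by
  have : NeZero (p ^ (k+1)) := ⟨pow_ne_zero _ hp.ne_zero⟩
  apply A3_zero_of n _ ((p ^ k : ℕ) : ZMod (p ^ (k+1)))
  · rw [← Nat.cast_pow, ZMod.natCast_eq_zero_iff, ← pow_mul]
    exact pow_dvd_pow _ (by omega)
  · have e2 : ∀ m : ℕ, (2 : ZMod (p ^ (k+1))) * (m : ZMod (p ^ (k+1))) = ((2 * m : ℕ) : ZMod (p ^ (k+1))) := by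
      intro m; push_cast; rfl
    rw [e2, Ne, ZMod.natCast_eq_zero_iff, pow_succ, mul_comm 2]
    intro h
    have := Nat.dvd_of_mul_dvd_mul_left (pow_pos hp.pos k) h
    exact h2 ((Nat.prime_dvd_prime_iff_eq hp Nat.prime_two).1 this)

lemma A3_two_zero (n k : ℕ) (hk : 3 ≤ k) : A3 n (2 ^ (k + 1)) = 0 := by
  have : NeZero (2 ^ (k+1)) := ⟨pow_ne_zero _ (by norm_num)⟩
  obtain ⟨j, rfl⟩ : ∃ j, k = j + 1 := ⟨k - 1, by omega⟩
  apply A3_zero_of n _ ((2 ^ j : ℕ) : ZMod (2 ^ (j+1+1)))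
  · rw [← Nat.cast_pow, ZMod.natCast_eq_zero_iff, ← pow_mul]
    exact pow_dvd_pow _ (by omega)
  · have e2 : ∀ m : ℕ, (2 : ZMod (2 ^ (j+1+1))) * (m : ZMod (2 ^ (j+1+1))) = ((2 * m : ℕ) : ZMod (2 ^ (j+1+1))) := by
      intro m; push_cast; rfl
    rw [e2, Ne, ZMod.natCast_eq_zero_iff, ← pow_succ']
    intro h
    have := (Nat.pow_dvd_pow_iff_le_right (by norm_num : 1 < 2)).1 h
    omega

lemma A3_small (n q : ℕ) [NeZero q] (hu : ∀ u : (ZMod q)ˣ, (u : ZMod q) ^ 2 = 1)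
    (hn : (n : ZMod q) = 3) : A3 n q = (Nat.totient q : ℝ) := by
  have hG : ∀ v : (ZMod q)ˣ, GG q v = (Nat.totient q : ℂ) * ZMod.stdAddChar (v : ZMod q) := by
    intro v
    simp [GG, hu, ZMod.card_units_eq_totient]
  rw [A3_eq]
  have : ∀ v : (ZMod q)ˣ, (GG q v) ^ 3 * ZMod.stdAddChar (-((v : ZMod q) * (n : ZMod q)))
      = (Nat.totient q : ℂ) ^ 3 := by
    intro v
    rw [hG, mul_pow, mul_assoc, ← AddChar.map_nsmul_eq_pow, ← AddChar.map_add_eq_mul, hn]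
    have : 3 • (v : ZMod q) + -(↑v * 3) = 0 := by simp; ring
    rw [this]; simp
  have h0 : (Nat.totient q : ℂ) ≠ 0 := by
    have := Nat.totient_pos.2 (Nat.pos_of_ne_zero (NeZero.ne q))
    exact_mod_cast this.ne'
  simp [this, ZMod.card_units_eq_totient]
  field_simp

/-- primes up to N -/
def PL (N : ℕ) : Finset ℕ := (Finset.Icc 1 N).filter Nat.Prime

lemma sum_log_div (N : ℕ) (hN : 1 ≤ N) :
    ∑ p ∈ PL N, Real.log p / p ≤ 2 * Real.log N := by
  have hm : ∀ m ∈ Finset.Icc 1 N, ∑ p ∈ (PL N).filter (fun p => p ∣ m), Real.log p ≤ Real.log N := by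
    intro m hm
    rw [Finset.mem_Icc] at hm
    have hs : ∑ p ∈ (PL N).filter (fun p => p ∣ m), Real.log p ≤ ∑ p ∈ m.primeFactors, Real.log p := by
      apply Finset.sum_le_sum_of_subset_of_nonneg
      · intro p hp
        simp only [PL, Finset.mem_filter] at hp
        exact Nat.mem_primeFactors.2 ⟨hp.1.2, hp.2, by omega⟩
      · intro p _ _
        exact Real.log_natCast_nonneg p
    refine hs.trans ?_
    rw [← Real.log_prod (fun p hp => by
      have := (Nat.prime_of_mem_primeFactors hp).pos
      positivity)]
    have hle : ∏ p ∈ m.primeFactors, p ≤ N :=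
      (Nat.le_of_dvd (by omega) (Nat.prod_primeFactors_dvd m)).trans hm.2
    have hpos : 0 < ∏ p ∈ m.primeFactors, p := Finset.prod_pos fun p hp => Nat.pos_of_mem_primeFactors hp
    rw [← Nat.cast_prod]
    exact Real.log_le_log (by exact_mod_cast hpos) (by exact_mod_cast hle)
  have h1 := Finset.sum_le_sum hm
  simp only [Finset.sum_const, Nat.card_Icc, Finset.sum_filter] at h1
  rw [Finset.sum_comm] at h1
  have h2 : ∀ p ∈ PL N, (N : ℝ) / 2 * (Real.log p / p) ≤
      ∑ m ∈ Finset.Icc 1 N, if p ∣ m then Real.log p else 0 := by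
    intro p hp
    simp only [PL, Finset.mem_filter, Finset.mem_Icc] at hp
    rw [← Finset.sum_filter, Finset.sum_const, nsmul_eq_mul]
    have hc : ((Finset.Icc 1 N).filter (fun m => p ∣ m)).card = N / p := by
      rw [← Nat.card_multiples' N p]
      congr 1
      ext k
      simp only [Finset.mem_filter, Finset.mem_Icc, Finset.mem_range]
      omega
    rw [hc]
    have hp0 : (0:ℝ) < p := by exact_mod_cast hp.2.pos
    have hl : 0 ≤ Real.log p := Real.log_natCast_nonneg p
    have hf : (N : ℝ) / 2 / p ≤ ((N / p : ℕ) : ℝ) := by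
      have h3 : N < 2 * p * (N / p) := by
        have h4 := Nat.div_add_mod N p
        have h5 := Nat.mod_lt N hp.2.pos
        have h6 : 1 ≤ N / p := (Nat.one_le_div_iff hp.2.pos).2 hp.1.2
        nlinarith
      have h3' : (N : ℝ) < 2 * p * ((N / p : ℕ) : ℝ) := by exact_mod_cast h3
      rw [div_div, div_le_iff₀ (by positivity)]
      nlinarith
    calc (N : ℝ) / 2 * (Real.log p / p) = (N : ℝ) / 2 / p * Real.log p := by ring
      _ ≤ _ := mul_le_mul_of_nonneg_right hf hl
  have h3 := (Finset.sum_le_sum h2).trans h1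
  rw [← Finset.mul_sum] at h3
  simp only [nsmul_eq_mul, Nat.add_sub_cancel] at h3
  have hN0 : (0 : ℝ) < N := by exact_mod_cast hN
  have : (N : ℝ) * (∑ p ∈ PL N, Real.log p / p) ≤ N * (2 * Real.log N) := by linarith
  exact le_of_mul_le_mul_left this hN0

lemma sum_rpow_le (s : ℝ) (hs : 1 < s) (N : ℕ) :
    ∑ p ∈ PL N, ((p : ℝ) ^ s)⁻¹ ≤ Real.log (∑' n : ℕ, 1 / (n : ℝ) ^ s) := by
  let f : ℕ →* ℝ :=
    { toFun := fun n => 1 / (n : ℝ) ^ s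
      map_one' := by simp
      map_mul' := by
        intro a b
        push_cast
        rw [Real.mul_rpow (by positivity) (by positivity)]
        simp only [one_div, mul_inv] }
  have hsum : Summable f := Real.summable_one_div_nat_rpow.2 hs
  have hprod := EulerProduct.prod_primesBelow_geometric_eq_tsum_smoothNumbers hsum (N+1)
  have hPL : (N+1).primesBelow = PL N := by
    ext p
    simp only [Nat.mem_primesBelow, PL, Finset.mem_filter, Finset.mem_Icc]
    constructor
    · rintro ⟨h, h'⟩; exact ⟨⟨h'.one_lt.le, by omega⟩, h'⟩
    · rintro ⟨h, h'⟩; exact ⟨by omega, h'⟩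
  rw [hPL] at hprod
  have hle : ∑' m : (N+1).smoothNumbers, f m ≤ ∑' n, f n :=
    hsum.tsum_subtype_le (fun n => f n) _ (fun n => by simp only [f]; show 0 ≤ 1 / (n:ℝ)^s; positivity)
  rw [← hprod] at hle
  have hf1 : ∀ p ∈ PL N, 0 < 1 - f p := by
    intro p hp
    simp only [PL, Finset.mem_filter] at hp
    have : (1:ℝ) < (p:ℝ)^s := Real.one_lt_rpow (by exact_mod_cast hp.2.one_lt) (by linarith)
    show 0 < 1 - 1 / (p:ℝ)^s
    rw [sub_pos, div_lt_one (by linarith)]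
    exact this
  have hpos : 0 < ∏ p ∈ PL N, (1 - f p)⁻¹ := Finset.prod_pos fun p hp => inv_pos.2 (hf1 p hp)
  refine le_trans ?_ (Real.log_le_log hpos hle)
  rw [Real.log_prod (fun p hp => (inv_pos.2 (hf1 p hp)).ne')]
  refine Finset.sum_le_sum fun p hp => ?_
  rw [Real.log_inv]
  have := Real.log_le_sub_one_of_pos (hf1 p hp)
  have h2 : f p = ((p : ℝ) ^ s)⁻¹ := one_div _
  rw [← h2]
  linarith

lemma mertens : ∃ C : ℝ, ∀ P : ℝ, 3 ≤ P →
    ∑ p ∈ PL ⌊P⌋₊, (1 : ℝ) / p ≤ Real.log (Real.log P) + C := by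
  have ht := tendsto_sub_mul_tsum_nat_rpow
  have hev := ht.eventually (gt_mem_nhds (by norm_num : (1:ℝ) < 2))
  rw [eventually_nhdsWithin_iff, Metric.eventually_nhds_iff] at hev
  obtain ⟨ε, hε, hev⟩ := hev
  set d := ε / 2 with hd
  have hd0 : 0 < d := by positivity
  refine ⟨Real.log (2 / d) + 2 * d, fun P hP => ?_⟩
  have hlog : 1 ≤ Real.log P := by
    rw [Real.le_log_iff_exp_le (by linarith)]
    have := Real.exp_one_lt_d9
    linarith
  set L := Real.log P
  have hL0 : 0 < L := by linarith
  set N := ⌊P⌋₊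
  have hN1 : 1 ≤ N := Nat.le_floor (by norm_num; linarith)
  have hNL : Real.log N ≤ L :=
    Real.log_le_log (by exact_mod_cast hN1) (Nat.floor_le (by linarith))
  set s := 1 + d / L with hs
  have hdL : 0 < d / L := by positivity
  have hs1 : 1 < s := by linarith
  have hdLle : d / L ≤ d := div_le_self hd0.le hlog
  have hz := hev (y := s) (by
    rw [Real.dist_eq, hs]; simp only [add_sub_cancel_left]
    rw [abs_of_pos hdL]; linarith) hs1
  have hz2 : ∑' n : ℕ, 1 / (n : ℝ) ^ s ≤ 2 / d * L := by
    have : s - 1 = d / L := by rw [hs]; ring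
    rw [this] at hz
    have h3 : ∑' n : ℕ, 1 / (n : ℝ) ^ s < 2 / (d / L) := by
      rw [lt_div_iff₀ hdL]; linarith
    have h4 : 2 / (d / L) = 2 / d * L := by field_simp
    linarith
  have hzpos : 0 < ∑' n : ℕ, 1 / (n : ℝ) ^ s := by
    have := (Real.summable_one_div_nat_rpow.2 hs1).le_tsum 1 (fun j _ => by positivity)
    simp at this
    simp
    linarith
  have h1 := sum_rpow_le s hs1 N
  have h2 : Real.log (∑' n : ℕ, 1 / (n : ℝ) ^ s) ≤ Real.log (2 / d) + Real.log L := by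
    rw [← Real.log_mul (by positivity) (by positivity)]
    exact Real.log_le_log hzpos hz2
  have h3 : ∀ p ∈ PL N, (1:ℝ) / p ≤ ((p:ℝ)^s)⁻¹ + d / L * (Real.log p / p) := by
    intro p hp
    simp only [PL, Finset.mem_filter] at hp
    have hp0 : (0:ℝ) < p := by exact_mod_cast hp.2.pos
    have e1 : ((p:ℝ)^s)⁻¹ = 1 / p * Real.exp (-(Real.log p * (d / L))) := by
      rw [← Real.rpow_neg hp0.le, hs, neg_add, Real.rpow_add hp0, Real.rpow_neg_one,
        Real.rpow_def_of_pos hp0, one_div]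
      congr 2; ring
    have e2 := Real.add_one_le_exp (-(Real.log p * (d / L)))
    have e3 := mul_le_mul_of_nonneg_left e2 (by positivity : 0 ≤ 1 / (p:ℝ))
    rw [e1]
    have e4 : 1 / (p:ℝ) * (-(Real.log p * (d / L)) + 1) = 1 / p - d / L * (Real.log p / p) := by ring
    linarith
  have h4 := Finset.sum_le_sum h3
  rw [Finset.sum_add_distrib, ← Finset.mul_sum] at h4
  have h5 := mul_le_mul_of_nonneg_left (sum_log_div N hN1) hdL.le
  have h6 : d / L * (2 * Real.log N) ≤ 2 * d := by
    have : d / L * (2 * Real.log N) ≤ d / L * (2 * L) := by gcongr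
    have h7 : d / L * (2 * L) = 2 * d := by field_simp
    linarith
  linarith

lemma prod_bound (k B : ℝ) (hk : 0 ≤ k) (hB : 0 ≤ B) : ∃ K : ℝ, ∀ P : ℝ, 3 ≤ P → ∀ F : ℕ → ℝ,
    (∀ p : ℕ, p.Prime → Real.exp (-(k / p + B / p ^ 2)) ≤ F p ∧ F p ≤ Real.exp (k / p + B / p ^ 2)) →
    Real.exp (-K) * Real.log P ^ (-k) ≤ ∏ p ∈ PL ⌊P⌋₊, F p ∧
    ∏ p ∈ PL ⌊P⌋₊, F p ≤ Real.exp K * Real.log P ^ k := by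
  obtain ⟨C, hC⟩ := mertens
  have hsum : Summable (fun n : ℕ => 1 / (n:ℝ)^2) := Real.summable_one_div_nat_pow.2 (by norm_num)
  refine ⟨k * C + B * ∑' n : ℕ, 1 / (n:ℝ)^2, fun P hP F hF => ?_⟩
  have hlog : 0 < Real.log P := Real.log_pos (by linarith)
  set T := ∑' n : ℕ, 1 / (n:ℝ)^2
  have hS : ∑ p ∈ PL ⌊P⌋₊, (k / p + B / p ^ 2) ≤ k * Real.log (Real.log P) + (k * C + B * T) := by
    have h1 := mul_le_mul_of_nonneg_left (hC P hP) hk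
    have h2 := mul_le_mul_of_nonneg_left
      (hsum.sum_le_tsum (PL ⌊P⌋₊) (fun i _ => by positivity)) hB
    rw [Finset.mul_sum] at h1 h2
    simp only [mul_one_div] at h1 h2
    rw [Finset.sum_add_distrib]
    linarith
  have hF' : ∀ p ∈ PL ⌊P⌋₊, Real.exp (-(k / p + B / p ^ 2)) ≤ F p ∧ F p ≤ Real.exp (k / p + B / p ^ 2) :=
    fun p hp => hF p (Finset.mem_filter.1 hp).2
  constructor
  · refine le_trans ?_ (Finset.prod_le_prod (fun p _ => (Real.exp_pos _).le) (fun p hp => (hF' p hp).1))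
    rw [← Real.exp_sum, Finset.sum_neg_distrib, Real.rpow_def_of_pos hlog, ← Real.exp_add]
    apply Real.exp_le_exp.2
    linarith
  · refine le_trans (Finset.prod_le_prod (fun p hp => (Real.exp_pos _).le.trans (hF' p hp).1) (fun p hp => (hF' p hp).2)) ?_
    rw [← Real.exp_sum, Real.rpow_def_of_pos hlog, ← Real.exp_add]
    apply Real.exp_le_exp.2
    linarith

lemma sum_units_prime (p : ℕ) [Fact p.Prime] (f : ZMod p → ℂ) :
    ∑ u : (ZMod p)ˣ, f u = ∑ x : ZMod p, f x - f 0 := by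
  rw [← Finset.add_sum_erase Finset.univ f (Finset.mem_univ 0), add_sub_cancel_left]
  refine Finset.sum_bij (fun u _ => (u : ZMod p)) ?_ ?_ ?_ ?_
  · intro u _; simp
  · intro a _ b _ h; exact Units.ext h
  · intro b hb
    exact ⟨Units.mk0 b (by simpa using hb), by simp, by simp⟩
  · intros; rfl

lemma sum_char (p : ℕ) [Fact p.Prime] (b : ZMod p) :
    ∑ x : ZMod p, ZMod.stdAddChar (x * b) = if b = 0 then (p : ℂ) else 0 := by
  have := AddChar.sum_mulShift b (ZMod.isPrimitive_stdAddChar p)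
  rw [ZMod.card] at this
  split_ifs at this ⊢ <;> simpa using this

lemma A2_prime (n p : ℕ) [Fact p.Prime] : ∃ N : ℕ,
    N = (Finset.univ.filter (fun u : (ZMod p)ˣ => (u : ZMod p) ^ 2 = n)).card ∧
    A2 n p = ((-(p * N - (p - 1)) / (p - 1) ^ 2 : ℝ) : ℂ) := by
  refine ⟨_, rfl, ?_⟩
  have hp : p.Prime := Fact.out
  have : NeZero p := ⟨hp.ne_zero⟩
  have hT : ∑ v : (ZMod p)ˣ, GG p v * ZMod.stdAddChar (-((v : ZMod p) * (n : ZMod p)))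
      = ∑ u : (ZMod p)ˣ, ((if (u : ZMod p) ^ 2 = n then (p : ℂ) else 0) - 1) := by
    have : ∀ v : (ZMod p)ˣ, GG p v * ZMod.stdAddChar (-((v : ZMod p) * (n : ZMod p)))
        = ∑ u : (ZMod p)ˣ, ZMod.stdAddChar ((v : ZMod p) * ((u : ZMod p) ^ 2 - (n : ZMod p))) := by
      intro v
      rw [GG, Finset.sum_mul]
      refine Finset.sum_congr rfl fun u _ => ?_
      rw [← AddChar.map_add_eq_mul]
      congr 1; ring
    rw [Finset.sum_congr rfl (fun v _ => this v), Finset.sum_comm]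
    refine Finset.sum_congr rfl fun u _ => ?_
    rw [sum_units_prime p (fun v => ZMod.stdAddChar (v * ((u : ZMod p) ^ 2 - (n : ZMod p)))), sum_char]
    simp [sub_eq_zero]
  rw [A2_eq, hT, ArithmeticFunction.moebius_apply_prime hp, Nat.totient_prime hp,
    Finset.sum_sub_distrib, ← Finset.sum_filter]
  have h1 : 1 ≤ p := hp.one_lt.le
  simp only [Finset.sum_const, Finset.card_univ, ZMod.card_units, nsmul_eq_mul]
  push_cast [Nat.cast_sub h1]
  ring

lemma card_sq_le (n p : ℕ) [Fact p.Prime] :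
    (Finset.univ.filter (fun u : (ZMod p)ˣ => (u : ZMod p) ^ 2 = n)).card ≤ 2 := by
  by_cases h : ∃ u0 : (ZMod p)ˣ, (u0 : ZMod p) ^ 2 = n
  · obtain ⟨u0, h0⟩ := h
    refine (Finset.card_le_card (t := {u0, -u0}) ?_).trans Finset.card_le_two
    intro u hu
    simp only [Finset.mem_filter, Finset.mem_univ, true_and] at hu
    rw [← h0] at hu
    simp only [Finset.mem_insert, Finset.mem_singleton]
    rcases sq_eq_sq_iff_eq_or_eq_neg.1 hu with h | h
    · left; exact Units.ext h
    · right; exact Units.ext (by simpa using h)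
  · push Not at h
    rw [Finset.filter_false_of_mem (fun u _ => h u)]
    simp

lemma A3_prime (n p : ℕ) [Fact p.Prime] (h2 : p ≠ 2) : ∃ ε η : ℤ, (ε = 1 ∨ ε = -1) ∧
    (η = 0 ∨ η = 1 ∨ η = -1) ∧ (p ∣ n → η = 0) ∧
    A3 n p = (((η * (ε * p * (ε * p + 3)) - (3 * ε * p + 1) * (if p ∣ n then (p:ℝ) - 1 else -1))
      / (p - 1) ^ 3 : ℝ) : ℂ) := by
  have hp : p.Prime := Fact.out
  have : NeZero p := ⟨hp.ne_zero⟩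
  have hF : ringChar (ZMod p) ≠ 2 := by rwa [ZMod.ringChar_zmod_n]
  set χ : MulChar (ZMod p) ℂ := (quadraticChar (ZMod p)).ringHomComp (Int.castRingHom ℂ) with hχ
  have hχa : ∀ x, χ x = ((quadraticChar (ZMod p) x : ℤ) : ℂ) := fun x => by
    simp [hχ]
  have hχ1 : χ ≠ 1 := by
    rw [hχ]
    exact (MulChar.ringHomComp_ne_one_iff (RingHom.injective_int (Int.castRingHom ℂ))).2 (quadraticChar_ne_one hF)
  have hχ2 : χ.IsQuadratic := (quadraticChar_isQuadratic (ZMod p)).comp _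
  set ψ := ZMod.stdAddChar (N := p) with hψ
  set τ := gaussSum χ ψ with hτ
  have hτ2 : τ ^ 2 = χ (-1) * p := by
    have := gaussSum_sq hχ1 hχ2 (ZMod.isPrimitive_stdAddChar p)
    rwa [ZMod.card] at this
  have hshift : ∀ b : ZMod p, ∑ x : ZMod p, χ x * ψ (b * x) = χ b * τ := by
    intro b
    by_cases hb : b = 0
    · subst hb
      simp only [zero_mul, AddChar.map_zero_eq_one, mul_one]
      rw [MulChar.sum_eq_zero_of_ne_one hχ1, MulChar.map_zero, zero_mul]
    · have := gaussSum_mulShift_eq χ ψ (Units.mk0 b hb)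
      rw [hχ2.inv] at this
      rw [hτ]
      simpa [gaussSum, AddChar.mulShift_apply] using this
  have hGG : ∀ v : (ZMod p)ˣ, GG p v = χ v * τ - 1 := by
    intro v
    rw [GG, sum_units_prime p (fun u => ZMod.stdAddChar ((v : ZMod p) * u ^ 2))]
    have h1 : ∑ x : ZMod p, ψ ((v : ZMod p) * x ^ 2)
        = ∑ y : ZMod p, (χ y + 1) * ψ ((v : ZMod p) * y) := by
      rw [← Finset.sum_fiberwise Finset.univ (fun x : ZMod p => x ^ 2)]
      refine Finset.sum_congr rfl fun y _ => ?_
      have hc := quadraticChar_card_sqrts hF y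
      rw [Finset.sum_congr rfl (g := fun _ => ψ ((v : ZMod p) * y))
        (fun x hx => by rw [(Finset.mem_filter.1 hx).2])]
      rw [Finset.sum_const, nsmul_eq_mul, hχa]
      congr 1
      have hc' : ((Finset.univ.filter (fun x : ZMod p => x ^ 2 = y)).card : ℤ)
          = quadraticChar (ZMod p) y + 1 := by
        rw [← hc]; congr 2; ext; simp
      exact_mod_cast hc'
    have h3 : ∑ y : ZMod p, ψ ((v : ZMod p) * y) = 0 := by
      have := sum_char p (v : ZMod p)
      simp only [Units.ne_zero, if_false] at this
      rw [← this]
      exact Finset.sum_congr rfl fun y _ => by rw [mul_comm]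
    rw [h1]
    simp only [add_mul, one_mul, Finset.sum_add_distrib, hshift, h3]
    simp
  have hsq : ∀ v : (ZMod p)ˣ, χ v ^ 2 = 1 := by
    intro v
    rw [hχa]
    have := quadraticChar_sq_one (F := ZMod p) (a := v) (Units.ne_zero v)
    exact_mod_cast this
  have hcub : ∀ v : (ZMod p)ˣ, (GG p v) ^ 3 * ψ (-((v : ZMod p) * (n : ZMod p)))
      = (τ * (τ ^ 2 + 3)) * (χ v * ψ (-(n : ZMod p) * v))
        - (3 * τ ^ 2 + 1) * ψ ((v : ZMod p) * (-(n : ZMod p))) := by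
    intro v
    rw [hGG, show -((v : ZMod p) * (n : ZMod p)) = -(n : ZMod p) * v by ring,
      show (v : ZMod p) * -(n : ZMod p) = -(n : ZMod p) * v by ring]
    linear_combination ((χ v * τ ^ 3 - 3 * τ ^ 2) * ψ (-(n : ZMod p) * v)) * hsq v
  have hT : ∑ v : (ZMod p)ˣ, (GG p v) ^ 3 * ψ (-((v : ZMod p) * (n : ZMod p)))
      = (τ ^ 2 * (τ ^ 2 + 3)) * χ (-n)
        - (3 * τ ^ 2 + 1) * ((if p ∣ n then (p : ℂ) else 0) - 1) := by
    rw [Finset.sum_congr rfl (fun v _ => hcub v), Finset.sum_sub_distrib, ← Finset.mul_sum,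
      ← Finset.mul_sum, sum_units_prime p (fun v => χ v * ψ (-(n : ZMod p) * v)), hshift,
      sum_units_prime p (fun v => ψ (v * (-(n : ZMod p)))), sum_char]
    simp only [neg_eq_zero, ZMod.natCast_eq_zero_iff, MulChar.map_zero, zero_mul,
      AddChar.map_zero_eq_one]
    ring
  refine ⟨quadraticChar (ZMod p) (-1), quadraticChar (ZMod p) (-n), ?_, ?_, ?_, ?_⟩
  · exact quadraticChar_dichotomy (by simp)
  · exact quadraticChar_isQuadratic (ZMod p) (-n)
  · intro h
    rw [(ZMod.natCast_eq_zero_iff n p).2 h]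
    simp
  · rw [A3_eq, ← hψ, hT, hτ2, hχa, hχa, Nat.totient_prime hp]
    have h1 : 1 ≤ p := hp.one_lt.le
    push_cast [Nat.cast_sub h1]
    split_ifs <;> push_cast <;> ring

lemma zmod3_sq : ∀ x : ZMod 3, x ≠ 0 → x ^ 2 = 1 := by decide

lemma exp_lower (x F y : ℝ) (hx : x < 1) (hF : 1 - x ≤ F) (hy : x / (1 - x) ≤ y) :
    Real.exp (-y) ≤ F := by
  have h0 : 0 < 1 - x := by linarith
  refine le_trans ?_ hF
  rw [← Real.le_log_iff_exp_le h0]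
  have := Real.one_sub_inv_le_log_of_pos h0
  have h1 : 1 - (1 - x)⁻¹ = - (x / (1 - x)) := by field_simp; ring
  linarith

lemma exp_upper (x F y : ℝ) (hF : F ≤ 1 + x) (hy : x ≤ y) : F ≤ Real.exp y := by
  have := Real.add_one_le_exp y
  linarith

lemma local2 (n : ℕ) (hn : H2mem n) (p : ℕ) (hp : p.Prime) :
    ∃ F : ℝ, (1 + ∑' k : ℕ, A2 n (p ^ (k + 1))) = (F : ℂ) ∧
      Real.exp (-((1:ℝ) / p + 200 / p ^ 2)) ≤ F ∧ F ≤ Real.exp ((1:ℝ) / p + 200 / p ^ 2) := by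
  have : Fact p.Prime := ⟨hp⟩
  obtain ⟨N, hN, hA⟩ := A2_prime n p
  have ht : ∑' k : ℕ, A2 n (p ^ (k + 1)) = A2 n p := by
    rw [tsum_eq_single 0]
    · simp
    · intro k hk
      have : ¬ Squarefree (p ^ (k+1)) := by
        rw [Nat.squarefree_pow_iff hp.ne_one (by omega)]
        omega
      rw [A2, ArithmeticFunction.moebius_eq_zero_of_not_squarefree this]
      simp
  refine ⟨1 + (-(p * N - (p - 1)) / (p - 1) ^ 2 : ℝ), ?_, ?_⟩
  · rw [ht, hA]; push_cast; ring
  have hN2 : N ≤ 2 := hN ▸ card_sq_le n p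
  have hN2' : (N : ℝ) ≤ 2 := by exact_mod_cast hN2
  have hN0 : (0 : ℝ) ≤ N := Nat.cast_nonneg N
  have hp2 : (2 : ℝ) ≤ p := by exact_mod_cast hp.two_le
  have hd : 0 < ((p : ℝ) - 1) ^ 2 := by nlinarith
  constructor
  · by_cases h5 : 5 ≤ p
    · have h5' : (5 : ℝ) ≤ p := by exact_mod_cast h5
      have hq1 : (p:ℝ) - 1 ≠ 0 := by intro h; linarith
      have hxe : 1 - ((p : ℝ) + 1) / (p - 1) ^ 2 = p * (p - 3) / (p - 1) ^ 2 := by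
        field_simp; ring
      apply exp_lower (((p : ℝ) + 1) / (p - 1) ^ 2)
      · rw [div_lt_one hd]; nlinarith
      · have : -(((p : ℝ) + 1) / (p - 1) ^ 2) ≤ -(p * N - (p - 1)) / (p - 1) ^ 2 := by
          rw [← neg_div]
          gcongr
          nlinarith
        linarith
      · rw [hxe]
        have h3 : (0:ℝ) < p - 3 := by linarith
        have hp0 : (0:ℝ) < p := by linarith
        have e1 : ((p : ℝ) + 1) / (p - 1) ^ 2 / (p * (p - 3) / (p - 1) ^ 2) = (p + 1) / (p * (p - 3)) := by
          field_simp
        have e2 : (1:ℝ) / p + 200 / p ^ 2 = (p + 200) / p ^ 2 := by field_simp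
        rw [e1, e2, div_le_div_iff₀ (by positivity) (by positivity)]
        nlinarith
    · have hN00 : N = 0 := by
        rw [hN, Finset.card_eq_zero, Finset.filter_eq_empty_iff]
        intro u _ h
        obtain ⟨_, h2, h3⟩ := hn
        have hcases : p = 2 ∨ p = 3 := by
          have := hp.two_le
          have : p ≠ 4 := by rintro rfl; revert hp; decide
          omega
        rcases hcases with rfl | rfl
        · rw [(ZMod.natCast_eq_zero_iff n 2).2 h2] at h
          exact u.ne_zero (pow_eq_zero_iff (two_ne_zero) |>.1 h)
        · rw [zmod3_sq _ u.ne_zero] at h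
          have h' : ((1 : ℕ) : ZMod 3) = (n : ZMod 3) := by simpa using h
          rw [ZMod.natCast_eq_natCast_iff'] at h'
          omega
      rw [hN00]
      have h1 : Real.exp (-((1:ℝ) / p + 200 / p ^ 2)) ≤ 1 := by
        rw [Real.exp_le_one_iff]
        have : (0:ℝ) ≤ (1:ℝ) / p + 200 / p ^ 2 := by positivity
        linarith
      refine h1.trans ?_
      have : 0 ≤ -((p:ℝ) * ((0 : ℕ) : ℝ) - (p - 1)) / (p - 1) ^ 2 := by
        apply div_nonneg _ hd.le
        push_cast; linarith
      linarith
  · apply exp_upper (1 / ((p : ℝ) - 1))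
    · have : -((p:ℝ) * N - (p - 1)) / (p - 1) ^ 2 ≤ 1 / ((p : ℝ) - 1) := by
        rw [div_le_div_iff₀ hd (by linarith)]
        nlinarith [mul_nonneg (by linarith : (0:ℝ) ≤ p) hN0]
      linarith
    · have hp0 : (0:ℝ) < p := by linarith
      have e2 : (1:ℝ) / p + 200 / p ^ 2 = (p + 200) / p ^ 2 := by field_simp
      rw [e2, div_le_div_iff₀ (by linarith) (by positivity)]
      nlinarith

lemma local3 (n : ℕ) (hn : H3mem n) (p : ℕ) (hp : p.Prime) :
    ∃ F : ℝ, (1 + ∑' k : ℕ, A3 n (p ^ (k + 1))) = (F : ℂ) ∧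
      Real.exp (-((3:ℝ) / p + 200 / p ^ 2)) ≤ F ∧ F ≤ Real.exp ((3:ℝ) / p + 200 / p ^ 2) := by
  have : Fact p.Prime := ⟨hp⟩
  have hp2 : (2 : ℝ) ≤ p := by exact_mod_cast hp.two_le
  have h1 : Real.exp (-((3:ℝ) / p + 200 / p ^ 2)) ≤ 1 := by
    rw [Real.exp_le_one_iff]
    have : (0:ℝ) ≤ (3:ℝ) / p + 200 / p ^ 2 := by positivity
    linarith
  obtain ⟨hn24, hn5⟩ := hn
  have hnm : ∀ q : ℕ, q ∣ 24 → (n : ZMod q) = 3 := by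
    intro q hq
    have : n ≡ 3 [MOD q] := (show n ≡ 3 [MOD 24] from hn24).of_dvd hq
    have := (ZMod.natCast_eq_natCast_iff n 3 q).2 this
    simpa using this
  by_cases h2 : p = 2
  · subst h2
    have ht : ∑' k : ℕ, A3 n (2 ^ (k + 1)) = 7 := by
      rw [tsum_eq_sum (s := Finset.range 3)
        (fun k hk => A3_two_zero n k (by simpa using hk))]
      simp only [Finset.sum_range_succ, Finset.sum_range_zero]
      norm_num
      rw [A3_small n 2 (by decide) (hnm 2 (by norm_num)),
        A3_small n 4 (by decide) (hnm 4 (by norm_num)), A3_small n 8 (by decide) (hnm 8 (by norm_num)),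
        show Nat.totient 2 = 1 by decide, show Nat.totient 4 = 2 by decide,
        show Nat.totient 8 = 4 by decide]
      norm_num
    refine ⟨8, by rw [ht]; norm_num, h1.trans (by norm_num), ?_⟩
    apply exp_upper 7 <;> norm_num
  have ht : ∑' k : ℕ, A3 n (p ^ (k + 1)) = A3 n p := by
    rw [tsum_eq_single 0]
    · simp
    · intro k hk
      exact A3_odd_zero n p k hp h2 (by omega)
  by_cases h3 : p = 3
  · subst h3
    rw [ht, A3_small n 3 (by decide) (hnm 3 (by norm_num)), show Nat.totient 3 = 2 by decide]
    refine ⟨3, by norm_num, h1.trans (by norm_num), ?_⟩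
    apply exp_upper 2 <;> norm_num
  obtain ⟨ε, η, hε, hη, hdiv, hA⟩ := A3_prime n p h2
  have h5 : 5 ≤ p := by
    have := hp.two_le
    have : p ≠ 4 := by rintro rfl; revert hp; decide
    omega
  have h5' : (5 : ℝ) ≤ p := by exact_mod_cast h5
  have hd : 0 < ((p : ℝ) - 1) ^ 3 := by
    have : 0 < (p:ℝ) - 1 := by linarith
    positivity
  set T : ℝ := (η * (ε * p * (ε * p + 3)) - (3 * ε * p + 1) * (if p ∣ n then (p:ℝ) - 1 else -1)) with hT
  refine ⟨1 + T / (p - 1) ^ 3, by rw [ht, hA]; push_cast; ring, ?_⟩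
  by_cases hp5 : p = 5
  · subst hp5
    have hTb : |T| ≤ 56 := by
      rw [hT, if_neg hn5, abs_le]
      rcases hε with rfl | rfl <;> rcases hη with rfl | rfl | rfl <;> norm_num
    rw [abs_le] at hTb
    push_cast
    constructor
    · apply exp_lower (7/8) <;> norm_num
      linarith
    · apply exp_upper (7/8) <;> norm_num
      linarith
  have h7 : 7 ≤ p := by
    have : p ≠ 6 := by rintro rfl; revert hp; decide
    omega
  have h7' : (7 : ℝ) ≤ p := by exact_mod_cast h7
  have hTb : |T| ≤ (3 * p + 1) * (p - 1) := by
    rw [hT]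
    by_cases hd : p ∣ n
    · rw [hdiv hd, if_pos hd, abs_le]
      rcases hε with rfl | rfl <;> push_cast <;> constructor <;> nlinarith
    · rw [if_neg hd, abs_le]
      rcases hε with rfl | rfl <;> rcases hη with rfl | rfl | rfl <;> push_cast <;>
        constructor <;> nlinarith
  have hp1 : 0 < (p:ℝ) - 1 := by linarith
  have hx : |T / ((p:ℝ) - 1) ^ 3| ≤ (3 * (p:ℝ) + 1) / ((p:ℝ) - 1) ^ 2 := by
    rw [abs_div, abs_of_pos hd, div_le_div_iff₀ hd (by positivity)]
    calc |T| * ((p:ℝ) - 1) ^ 2 ≤ ((3 * p + 1) * (p - 1)) * (p - 1) ^ 2 := by gcongr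
      _ = _ := by ring
  rw [abs_le] at hx
  have hp0 : (0:ℝ) < p := by linarith
  have e2 : (3:ℝ) / p + 200 / p ^ 2 = (3 * p + 200) / p ^ 2 := by field_simp
  constructor
  · have hxe : 1 - (3 * (p : ℝ) + 1) / (p - 1) ^ 2 = p * (p - 5) / (p - 1) ^ 2 := by
      field_simp; ring
    apply exp_lower ((3 * (p : ℝ) + 1) / (p - 1) ^ 2)
    · rw [div_lt_one (by positivity)]; nlinarith
    · linarith
    · rw [hxe]
      have h3 : (0:ℝ) < p - 5 := by linarith
      have e1 : (3 * (p : ℝ) + 1) / (p - 1) ^ 2 / (p * (p - 5) / (p - 1) ^ 2)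
          = (3 * p + 1) / (p * (p - 5)) := by
        field_simp
      rw [e1, e2, div_le_div_iff₀ (by positivity) (by positivity)]
      nlinarith [mul_nonneg hp0.le (by linarith : (0:ℝ) ≤ p - 7)]
  · apply exp_upper ((3 * (p : ℝ) + 1) / (p - 1) ^ 2)
    · linarith
    · rw [e2, div_le_div_iff₀ (by positivity) (by positivity)]
      nlinarith [mul_nonneg hp0.le (by linarith : (0:ℝ) ≤ p - 7)]

/-- bounds for the partial singular products `𝔓₂` and `𝔓₃`. -/
theorem statement13 :
    ∃ c₁ c₂ : ℝ, 0 < c₁ ∧ 0 < c₂ ∧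
    ∀ P : ℝ, 3 ≤ P →
      (∀ n : ℕ, H2mem n →
        c₁ * (Real.log P)⁻¹ ≤ (PP2 n P).re ∧ ‖PP2 n P‖ ≤ c₂ * Real.log P) ∧
      (∀ n : ℕ, H3mem n →
        c₁ * Real.log P ^ (-3 : ℝ) ≤ (PP3 n P).re ∧ ‖PP3 n P‖ ≤ c₂ * Real.log P ^ (3 : ℝ)) := by
  obtain ⟨K, hK⟩ := prod_bound 1 200 (by norm_num) (by norm_num)
  obtain ⟨K', hK'⟩ := prod_bound 3 200 (by norm_num) (by norm_num)
  refine ⟨min (Real.exp (-K)) (Real.exp (-K')), max (Real.exp K) (Real.exp K'),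
    lt_min (Real.exp_pos _) (Real.exp_pos _), lt_max_of_lt_left (Real.exp_pos _), fun P hP => ?_⟩
  have hlog : 0 < Real.log P := Real.log_pos (by linarith)
  constructor
  · intro n hn
    have hl := local2 n hn
    choose! F hF1 hF2 using hl
    have hb := hK P hP F hF2
    have hPP : PP2 n P = ((∏ p ∈ PL ⌊P⌋₊, F p : ℝ) : ℂ) := by
      rw [PP2, Complex.ofReal_prod]
      exact Finset.prod_congr rfl fun p hp => hF1 p (Finset.mem_filter.1 hp).2
    rw [hPP, Complex.ofReal_re, Complex.norm_real, Real.norm_eq_abs]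
    rw [Real.rpow_neg_one, Real.rpow_one] at hb
    have h0 : 0 ≤ ∏ p ∈ PL ⌊P⌋₊, F p := le_trans (by positivity) hb.1
    rw [abs_of_nonneg h0]
    constructor
    · refine le_trans ?_ hb.1
      gcongr
      exact min_le_left _ _
    · refine hb.2.trans ?_
      gcongr
      exact le_max_left _ _
  · intro n hn
    have hl := local3 n hn
    choose! F hF1 hF2 using hl
    have hb := hK' P hP F hF2
    have hPP : PP3 n P = ((∏ p ∈ PL ⌊P⌋₊, F p : ℝ) : ℂ) := by
      rw [PP3, Complex.ofReal_prod]
      exact Finset.prod_congr rfl fun p hp => hF1 p (Finset.mem_filter.1 hp).2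
    rw [hPP, Complex.ofReal_re, Complex.norm_real, Real.norm_eq_abs]
    have h0 : 0 ≤ ∏ p ∈ PL ⌊P⌋₊, F p := le_trans (by positivity) hb.1
    rw [abs_of_nonneg h0]
    constructor
    · refine le_trans ?_ hb.1
      gcongr
      exact min_le_right _ _
    · refine hb.2.trans ?_
      gcongr
      exact le_max_right _ _
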